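/- arXiv:2101.08509 — 2 statements merged into one kernel-verified Lean document; each statement's English description precedes it below -/
import Mathlib

section
/- The infimum of the total curvature K(γ) = ∫_{S¹}|κ| ds over all non-embedded C² immersions γ: S¹ → ℝ² equals 2π, and it coincides with the infimum of K over all C² immersions γ: S¹ → ℝ². Moreover, the infimum over non-embedded immersions is not attained: every non-embedded C² immersion γ satisfies K(γ) > 2π. -/
open Real MeasureTheory Set Function intervalIntegral

noncomputable section

/-- The plane `ℝ²`, with the Euclidean norm. -/
abbrev R2 := EuclideanSpace ℝ (Fin 2)

/-- Planar determinant `det(v, w) = v₁w₂ - v₂w₁`. -/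
def det2 (v w : R2) : ℝ := v 0 * w 1 - v 1 * w 0

/-- A closed `C²` curve on `S¹ = ℝ/ℤ`: a 1-periodic `C²` function `ℝ → ℝ²`. -/
def IsClosedC2 (γ : ℝ → R2) : Prop := Function.Periodic γ 1 ∧ ContDiff ℝ 2 γ

/-- `γ` is an immersion. -/
def ImmersedC (γ : ℝ → R2) : Prop := ∀ x, deriv γ x ≠ 0

/-- The signed curvature `κ = det(γ', γ'')/|γ'|³`. -/
def curvC (γ : ℝ → R2) (x : ℝ) : ℝ := det2 (deriv γ x) (deriv (deriv γ) x) / ‖deriv γ x‖ ^ 3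

/-- The total curvature `K(γ) = ∫_{S¹} |κ| ds`. -/
def totalCurv (γ : ℝ → R2) : ℝ := ∫ x in (0:ℝ)..1, |curvC γ x| * ‖deriv γ x‖

/-- `γ` is non-embedded: not injective on `S¹ = ℝ/ℤ`. -/
def NonInjectiveC (γ : ℝ → R2) : Prop := ¬ Set.InjOn γ (Set.Ico (0:ℝ) 1)


lemma speed_eq (γ : ℝ → R2) (h : ImmersedC γ) (x : ℝ) :
    0 < (deriv γ x 0)^2 + (deriv γ x 1)^2 ∧
    curvC γ x * ‖deriv γ x‖ = det2 (deriv γ x) (deriv (deriv γ) x) /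
      ((deriv γ x 0)^2 + (deriv γ x 1)^2) := by
  have h1 : ‖deriv γ x‖^2 = (deriv γ x 0)^2 + (deriv γ x 1)^2 := by
    rw [EuclideanSpace.real_norm_sq_eq, Fin.sum_univ_two]
  have h2 : 0 < ‖deriv γ x‖ := norm_pos_iff.2 (h x)
  rw [← h1]
  refine ⟨by positivity, ?_⟩
  unfold curvC
  field_simp

lemma coord_deriv {γ : ℝ → R2} {v : R2} {x : ℝ} (h : HasDerivAt γ v x) (i : Fin 2) :
    HasDerivAt (fun t => γ t i) (v i) x :=
  (EuclideanSpace.proj i : R2 →L[ℝ] ℝ).hasFDerivAt.comp_hasDerivAt x h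

lemma lift_exists (γ : ℝ → R2) (hc : IsClosedC2 γ) (h : ImmersedC γ) :
    ∃ (θ ρ k : ℝ → ℝ) , Continuous k ∧ (∀ x, k x = curvC γ x * ‖deriv γ x‖) ∧
      (∀ x, HasDerivAt θ (k x) x) ∧ (∀ x, 0 < ρ x) ∧
      (∀ x, HasDerivAt (fun t => γ t 0) (ρ x * cos (θ x)) x) ∧
      (∀ x, HasDerivAt (fun t => γ t 1) (ρ x * sin (θ x)) x) := by
  have d1 : ContDiff ℝ 1 (deriv γ) := by
    have := hc.2
    rw [show (2 : WithTop ℕ∞) = 1 + 1 by norm_num, contDiff_succ_iff_deriv] at this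
    exact this.2.2
  have g1 : ∀ x, HasDerivAt γ (deriv γ x) x := fun x =>
    (hc.2.differentiable (by norm_num) x).hasDerivAt
  have g2 : ∀ x, HasDerivAt (deriv γ) (deriv (deriv γ) x) x := fun x =>
    (d1.differentiable (by norm_num) x).hasDerivAt
  have c1 : Continuous (deriv γ) := d1.continuous
  have c2 : Continuous (deriv (deriv γ)) := d1.continuous_deriv (by norm_num)
  have cc1 : ∀ i, Continuous (fun x => deriv γ x i) := fun i =>
    (EuclideanSpace.proj i : R2 →L[ℝ] ℝ).continuous.comp c1
  have cc2 : ∀ i, Continuous (fun x => deriv (deriv γ) x i) := fun i =>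
    (EuclideanSpace.proj i : R2 →L[ℝ] ℝ).continuous.comp c2
  set z : ℝ → ℂ := fun x => (deriv γ x 0 : ℂ) + (deriv γ x 1 : ℂ) * Complex.I with hz
  set z' : ℝ → ℂ := fun x => (deriv (deriv γ) x 0 : ℂ) + (deriv (deriv γ) x 1 : ℂ) * Complex.I
    with hz'
  have hzre : ∀ x, (z x).re = deriv γ x 0 := by intro x; simp [hz]
  have hzim : ∀ x, (z x).im = deriv γ x 1 := by intro x; simp [hz]
  have hzre' : ∀ x, (z' x).re = deriv (deriv γ) x 0 := by intro x; simp [hz']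
  have hzim' : ∀ x, (z' x).im = deriv (deriv γ) x 1 := by intro x; simp [hz']
  have hns : ∀ x, Complex.normSq (z x) = (deriv γ x 0)^2 + (deriv γ x 1)^2 := by
    intro x; rw [Complex.normSq_apply, hzre, hzim]; ring
  have hz0 : ∀ x, z x ≠ 0 := by
    intro x h0
    have := (speed_eq γ h x).1
    rw [← hns, h0] at this
    simp at this
  have hdz : ∀ x, HasDerivAt z (z' x) x := fun x =>
    ((coord_deriv (g2 x) 0).ofReal_comp).add (((coord_deriv (g2 x) 1).ofReal_comp).mul_const _)
  have cz : Continuous z := continuous_iff_continuousAt.2 fun x => (hdz x).continuousAt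
  have cz' : Continuous z' := by
    have a := cc2 0
    have b := cc2 1
    exact (Complex.continuous_ofReal.comp a).add ((Complex.continuous_ofReal.comp b).mul continuous_const)
  have cq : Continuous (fun x => z' x / z x) := cz'.div cz hz0
  set Λ : ℝ → ℂ := fun x => Complex.log (z 0) + ∫ t in (0:ℝ)..x, z' t / z t with hΛ
  have hdΛ : ∀ x, HasDerivAt Λ (z' x / z x) x := fun x =>
    (cq.integral_hasStrictDerivAt 0 x).hasDerivAt.const_add _
  have hconst : ∀ x, z x * Complex.exp (-Λ x) = 1 := by
    have hd : ∀ x, HasDerivAt (fun x => z x * Complex.exp (-Λ x)) 0 x := by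
      intro x
      refine ((hdz x).mul ((hdΛ x).neg.cexp)).congr_deriv ?_
      have := hz0 x
      field_simp
      simp
    intro x
    have := is_const_of_deriv_eq_zero (fun x => (hd x).differentiableAt) (fun x => (hd x).deriv) x 0
    rw [this]
    simp [hΛ, Complex.exp_neg, Complex.exp_log (hz0 0), hz0 0]
  have hexp : ∀ x, z x = Complex.exp (Λ x) := by
    intro x
    have := hconst x
    rw [Complex.exp_neg] at this
    field_simp at this
    exact this
  refine ⟨fun x => (Λ x).im, fun x => Real.exp (Λ x).re, fun x => (z' x / z x).im,
    Complex.continuous_im.comp cq, ?_, ?_, fun x => Real.exp_pos _, ?_, ?_⟩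
  · intro x
    show (z' x / z x).im = _
    rw [(speed_eq γ h x).2, Complex.div_im, hns, hzre, hzim, hzre', hzim']
    unfold det2
    ring
  · intro x
    exact Complex.imCLM.hasFDerivAt.comp_hasDerivAt x (hdΛ x)
  · intro x
    have := coord_deriv (g1 x) 0
    rwa [← hzre, hexp, Complex.exp_re] at this
  · intro x
    have := coord_deriv (g1 x) 1
    rwa [← hzim, hexp, Complex.exp_im] at this

/-- On a loop, the tangent angle oscillates by more than `π`. -/
lemma loop_range {X Y θ ρ : ℝ → ℝ} (hθ : Continuous θ) (hρ : ∀ x, 0 < ρ x)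
    (hX : ∀ x, HasDerivAt X (ρ x * cos (θ x)) x) (hY : ∀ x, HasDerivAt Y (ρ x * sin (θ x)) x)
    {a b : ℝ} (hab : a < b) (eX : X a = X b) (eY : Y a = Y b) :
    ∃ p ∈ Icc a b, ∃ q ∈ Icc a b, π < θ q - θ p := by
  by_contra! hcon
  obtain ⟨p, hp, hmin⟩ := isCompact_Icc.exists_isMinOn (nonempty_Icc.2 hab.le) hθ.continuousOn
  have hC : ∀ x, HasDerivAt (fun t => cos (θ p) * X t + sin (θ p) * Y t)
      (ρ x * cos (θ x - θ p)) x := by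
    intro x
    refine (((hX x).const_mul (cos (θ p))).add ((hY x).const_mul (sin (θ p)))).congr_deriv ?_
    rw [cos_sub]; ring
  have hS : ∀ x, HasDerivAt (fun t => cos (θ p) * Y t - sin (θ p) * X t)
      (ρ x * sin (θ x - θ p)) x := by
    intro x
    refine (((hY x).const_mul (cos (θ p))).sub ((hX x).const_mul (sin (θ p)))).congr_deriv ?_
    rw [sin_sub]; ring
  obtain ⟨c, hc, hc0⟩ := exists_hasDerivAt_eq_zero hab
    (fun x _ => (hC x).continuousAt.continuousWithinAt) (by simp only [eX, eY]) (fun x _ => hC x)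
  have hmono : MonotoneOn (fun t => cos (θ p) * Y t - sin (θ p) * X t) (Icc a b) := by
    apply monotoneOn_of_deriv_nonneg (convex_Icc a b)
      (fun x _ => (hS x).continuousAt.continuousWithinAt)
      (fun x _ => (hS x).differentiableAt.differentiableWithinAt)
    intro x hx
    have hx' := interior_subset hx
    rw [(hS x).deriv]
    exact mul_nonneg (hρ x).le (sin_nonneg_of_nonneg_of_le_pi
      (sub_nonneg.2 (hmin hx')) (hcon p hp x hx'))
  have hconst : ∀ x ∈ Icc a b, cos (θ p) * Y x - sin (θ p) * X x
      = cos (θ p) * Y a - sin (θ p) * X a := by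
    intro x hx
    apply le_antisymm
    · have := hmono hx (right_mem_Icc.2 hab.le) hx.2
      simpa only [eX, eY] using this
    · exact hmono (left_mem_Icc.2 hab.le) hx hx.1
  have h0 : ρ c * sin (θ c - θ p) = 0 := by
    refine (hS c).unique ((hasDerivAt_const c (cos (θ p) * Y a - sin (θ p) * X a)).congr_of_eventuallyEq ?_)
    filter_upwards [Icc_mem_nhds hc.1 hc.2] with x hx using hconst x hx
  have h1 := (mul_eq_zero.1 h0).resolve_left (hρ c).ne'
  have h2 := (mul_eq_zero.1 hc0).resolve_left (hρ c).ne'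
  have := sin_sq_add_cos_sq (θ c - θ p)
  rw [h1, h2] at this
  norm_num at this

lemma var_ge {θ k : ℝ → ℝ} (hk : Continuous k) (hθ : ∀ x, HasDerivAt θ (k x) x) {a b : ℝ}
    (hab : a ≤ b) : |θ b - θ a| ≤ ∫ x in a..b, |k x| := by
  rw [← integral_eq_sub_of_hasDerivAt (fun x _ => hθ x) (hk.intervalIntegrable _ _)]
  exact abs_integral_le_integral_abs hab

lemma var_ge3 {θ k : ℝ → ℝ} (hk : Continuous k) (hθ : ∀ x, HasDerivAt θ (k x) x) {a p q b : ℝ}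
    (h1 : a ≤ p) (h2 : p ≤ q) (h3 : q ≤ b) :
    |θ p - θ a| + |θ q - θ p| + |θ b - θ q| ≤ ∫ x in a..b, |k x| := by
  have hi : ∀ s t, IntervalIntegrable (fun x => |k x|) volume s t :=
    fun s t => hk.abs.intervalIntegrable _ _
  rw [← integral_add_adjacent_intervals (hi a q) (hi q b),
    ← integral_add_adjacent_intervals (hi a p) (hi p q)]
  gcongr
  · exact var_ge hk hθ h1
  · exact var_ge hk hθ h2
  · exact var_ge hk hθ h3

lemma var_loop {θ k : ℝ → ℝ} (hk : Continuous k) (hθ : ∀ x, HasDerivAt θ (k x) x) {a b p q : ℝ}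
    (hp : p ∈ Icc a b) (hq : q ∈ Icc a b) :
    |θ q - θ p| + |(θ b - θ a) - abs (θ q - θ p)| ≤ ∫ x in a..b, |k x| ∨ 
    |θ q - θ p| + |(θ b - θ a) + abs (θ q - θ p)| ≤ ∫ x in a..b, |k x| := by
  rcases le_total p q with h | h
  · have := var_ge3 hk hθ hp.1 h hq.2
    grind
  · have := var_ge3 hk hθ hq.1 h hp.2
    grind

lemma tc_gt (γ : ℝ → R2) (hc : IsClosedC2 γ) (h : ImmersedC γ) (hn : NonInjectiveC γ) :
    2 * π < totalCurv γ := by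
  obtain ⟨θ, ρ, k, hk, hkc, hθ, hρ, hX, hY⟩ := lift_exists γ hc h
  have hθc : Continuous θ := continuous_iff_continuousAt.2 fun x => (hθ x).continuousAt
  have hdp : Function.Periodic (deriv γ) 1 := by
    intro x
    have := deriv_comp_add_const γ 1 x
    rw [← this]; congr 1; funext t; exact hc.1 t
  have hddp : Function.Periodic (deriv (deriv γ)) 1 := by
    intro x
    have := deriv_comp_add_const (deriv γ) 1 x
    rw [← this]; congr 1; funext t; exact hdp t
  have hkp : Function.Periodic (fun x => |k x|) 1 := by
    intro x
    simp only [hkc, curvC, hdp x, hddp x]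
  have htc : totalCurv γ = ∫ x in (0:ℝ)..1, |k x| := by
    unfold totalCurv; congr 1; funext x; rw [hkc, abs_mul, abs_norm]
  have key : ∀ a b, a < b → γ a = γ b → π < ∫ x in a..b, |k x| := by
    intro a b hab e
    obtain ⟨p, hp, q, hq, hpq⟩ := loop_range hθc hρ hX hY hab (by simp [e]) (by simp [e])
    have := var_loop hk hθ hp hq
    grind
  have key2 : ∀ a b, 0 ≤ a → a < b → b < 1 → γ a = γ b → 2 * π < totalCurv γ := by
    intro a b ha hab hb e
    have h1 := key a b hab e
    have h2 := key b (a+1) (by linarith) (by rw [hc.1 a, e])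
    have h3 := hkp.intervalIntegral_add_eq 0 a
    have h4 := integral_add_adjacent_intervals (μ := volume) (hk.abs.intervalIntegrable a b)
      (hk.abs.intervalIntegrable b (a+1))
    rw [zero_add] at h3
    rw [htc, h3, ← h4]
    linarith
  unfold NonInjectiveC InjOn at hn
  push Not at hn
  obtain ⟨a, ha, b, hb, e, hne⟩ := hn
  rcases lt_or_gt_of_ne hne with hlt | hlt
  · exact key2 a b ha.1 hlt hb.2 e
  · exact key2 b a hb.1 hlt ha.2 e.symm

lemma tc_ge (γ : ℝ → R2) (hc : IsClosedC2 γ) (h : ImmersedC γ) :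
    2 * π ≤ totalCurv γ := by
  obtain ⟨θ, ρ, k, hk, hkc, hθ, hρ, hX, hY⟩ := lift_exists γ hc h
  have hθc : Continuous θ := continuous_iff_continuousAt.2 fun x => (hθ x).continuousAt
  have htc : totalCurv γ = ∫ x in (0:ℝ)..1, |k x| := by
    unfold totalCurv; congr 1; funext x; rw [hkc, abs_mul, abs_norm]
  have e : γ 0 = γ 1 := by simpa using (hc.1 0).symm
  obtain ⟨p, hp, q, hq, hpq⟩ := loop_range hθc hρ hX hY one_pos (by simp [e]) (by simp [e])
  have hv := var_loop hk hθ hp hq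
  have hper : ∀ i, HasDerivAt (fun t => γ t i) (deriv (fun t => γ t i) 1) 0 := by
    intro i
    have hd : DifferentiableAt ℝ (fun t => γ t i) 1 := 
      (coord_deriv (hc.2.differentiable (by norm_num) 1).hasDerivAt i).differentiableAt
    have := hd.hasDerivAt
    have h2 : HasDerivAt (fun t => γ (t + 1) i) (deriv (fun t => γ t i) 1) 0 :=
      HasDerivAt.comp_add_const (f := fun t => γ t i) (0:ℝ) 1 (by rw [zero_add]; exact this)
    simpa only [hc.1 _] using h2
  have e0 := (hX 0).unique (hper 0)
  have e1 := (hY 0).unique (hper 1)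
  rw [(hX 1).deriv] at e0
  rw [(hY 1).deriv] at e1
  have er : ρ 0 = ρ 1 := by
    have : ρ 0 ^ 2 = ρ 1 ^ 2 := by
      have a := sin_sq_add_cos_sq (θ 0)
      have b := sin_sq_add_cos_sq (θ 1)
      linear_combination (-ρ 0^2) * a + (ρ 1^2) * b + (ρ 0 * cos (θ 0) + ρ 1 * cos (θ 1)) * e0
        + (ρ 0 * sin (θ 0) + ρ 1 * sin (θ 1)) * e1
    exact (pow_left_inj₀ (hρ 0).le (hρ 1).le (by norm_num)).1 this
  rw [er] at e0 e1
  have e0 := mul_left_cancel₀ (hρ 1).ne' e0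
  have e1 := mul_left_cancel₀ (hρ 1).ne' e1
  have hcos : cos (θ 1 - θ 0) = 1 := by
    rw [cos_sub, e0, e1]; nlinarith [sin_sq_add_cos_sq (θ 1)]
  obtain ⟨n, hn⟩ := (cos_eq_one_iff _).1 hcos
  rw [htc]
  by_cases hn0 : n = 0
  · subst hn0
    rw [← hn] at hv
    simp at hv
    grind
  · have h1 := var_ge hk hθ (zero_le_one (α := ℝ))
    refine le_trans ?_ h1
    rw [← hn, abs_mul, abs_of_pos (by positivity : 0 < 2 * π)]
    have : (1:ℝ) ≤ |(n:ℝ)| := by exact_mod_cast Int.one_le_abs hn0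
    nlinarith [pi_pos]

lemma deriv_mk' {f g : ℝ → ℝ} {f' g' x : ℝ} (hf : HasDerivAt f f' x) (hg : HasDerivAt g g' x) :
    HasDerivAt (fun t => (!₂[f t, g t] : R2)) !₂[f', g'] x := by
  have := (hasDerivAt_pi (φ := fun t => ![f t, g t]) (φ' := ![f', g']) (x := x)).2 (by
    intro i
    fin_cases i
    · simpa using hf
    · simpa using hg)
  exact (PiLp.continuousLinearEquiv 2 ℝ (fun _ : Fin 2 => ℝ)).symm.hasFDerivAt.comp_hasDerivAt x this

/-- Thin figure eight. -/
def eight (c : ℝ) (t : ℝ) : R2 := !₂[sin (2 * π * t), c / 2 * sin (2 * (2 * π * t))]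

lemma lin_d (x : ℝ) : HasDerivAt (fun t : ℝ => 2 * π * t) (2 * π) x := by
  simpa using (hasDerivAt_id x).const_mul (2 * π)

lemma lin_d2 (x : ℝ) : HasDerivAt (fun t : ℝ => 2 * (2 * π * t)) (2 * (2 * π)) x := 
  (lin_d x).const_mul 2

lemma eight_d (c : ℝ) : deriv (eight c) = fun x =>
    !₂[2 * π * cos (2 * π * x), 2 * π * c * cos (2 * (2 * π * x))] := by
  funext x
  apply HasDerivAt.deriv
  have := deriv_mk' (lin_d x).sin ((lin_d2 x).sin.const_mul (c/2))
  unfold eight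
  refine this.congr_deriv ?_
  congr 1
  ext i
  fin_cases i
  · simp; ring
  · simp; ring

lemma eight_dd (c : ℝ) : deriv (deriv (eight c)) = fun x =>
    !₂[- (2 * π) ^ 2 * sin (2 * π * x), - (2 * π) ^ 2 * 2 * c * sin (2 * (2 * π * x))] := by
  rw [eight_d]
  funext x
  apply HasDerivAt.deriv
  have := deriv_mk' ((lin_d x).cos.const_mul (2 * π)) ((lin_d2 x).cos.const_mul (2 * π * c))
  refine this.congr_deriv ?_
  congr 1
  ext i
  fin_cases i
  · simp; ring
  · simp; ring

lemma den_pos {c : ℝ} (hc : 0 < c) (v : ℝ) : 0 < cos v ^ 2 + (c * cos (2 * v)) ^ 2 := by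
  by_cases h : cos v = 0
  · rw [cos_two_mul, h]; simp; positivity
  · positivity

lemma eight_props {c : ℝ} (hc : 0 < c) :
    IsClosedC2 (eight c) ∧ ImmersedC (eight c) ∧ NonInjectiveC (eight c) := by
  refine ⟨⟨?_, ?_⟩, ?_, ?_⟩
  · intro x
    unfold eight
    rw [show 2 * π * (x + 1) = 2 * π * x + 2 * π by ring, sin_add_two_pi, mul_add, sin_add (2 * (2 * π * x)),
      sin_two_mul (2 * π), cos_two_mul (2 * π)]
    norm_num
  · rw [contDiff_euclidean]
    intro i
    fin_cases i
    · simp [eight]; fun_prop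
    · simp [eight]; fun_prop
  · intro x hx
    rw [eight_d] at hx
    have h0 := congrArg (fun v : R2 => v 0) hx
    have h1 := congrArg (fun v : R2 => v 1) hx
    have := den_pos hc (2 * π * x)
    simp [pi_ne_zero, hc.ne'] at h0 h1
    rw [h0, h1] at this
    simp at this
  · intro hinj
    have := hinj (x₁ := 0) (x₂ := 1/2) (by norm_num) (by norm_num) (by
      unfold eight
      rw [show 2 * π * (1/2) = π by ring]; simp)
    norm_num at this

def kk (c x : ℝ) : ℝ := 2 * π * (- (c * sin (2 * π * x) * (1 + 2 * cos (2 * π * x) ^ 2))) /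
  (cos (2 * π * x) ^ 2 + (c * cos (2 * (2 * π * x))) ^ 2)

lemma kk_cont {c : ℝ} (hc : 0 < c) : Continuous (kk c) := by
  unfold kk
  apply Continuous.div (by fun_prop) (by fun_prop)
  intro x
  exact (den_pos hc _).ne'

lemma eight_curv {c : ℝ} (hc : 0 < c) (x : ℝ) :
    |curvC (eight c) x| * ‖deriv (eight c) x‖ = |kk c x| := by
  have h1 : ‖deriv (eight c) x‖^2 = (2 * π)^2 * (cos (2 * π * x) ^ 2 + (c * cos (2 * (2 * π * x))) ^ 2) := by
    rw [EuclideanSpace.real_norm_sq_eq, Fin.sum_univ_two, eight_d]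
    simp; ring
  have h2 : 0 < ‖deriv (eight c) x‖ := norm_pos_iff.2 ((eight_props hc).2.1 x)
  have hp := den_pos hc (2 * π * x)
  rw [← abs_of_pos h2, ← abs_mul]
  congr 1
  have : curvC (eight c) x * ‖deriv (eight c) x‖ = det2 (deriv (eight c) x) (deriv (deriv (eight c)) x) / ‖deriv (eight c) x‖^2 := by
    unfold curvC
    field_simp
  rw [this, h1, eight_dd, eight_d]
  unfold kk det2
  have hpi := pi_pos
  rw [div_eq_div_iff (by positivity) (by positivity)]
  simp only [PiLp.toLp_apply, Matrix.cons_val_zero, Matrix.cons_val_one]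
  generalize cos (2 * π * x) ^ 2 + (c * cos (2 * (2 * π * x))) ^ 2 = D
  rw [sin_two_mul, cos_two_mul]
  ring

def FF (c x : ℝ) : ℝ := (Complex.log ((-c * cos (2 * (2 * π * x)) : ℝ) + (cos (2 * π * x) : ℝ) * Complex.I)).im

lemma FF_d {c : ℝ} (hc : 0 < c) (x : ℝ) : HasDerivAt (FF c) (kk c x) x := by
  have hw : HasDerivAt (fun x : ℝ => (((-c * cos (2 * (2 * π * x)) : ℝ) : ℂ) + (cos (2 * π * x) : ℝ) * Complex.I))
     ((-c * (-sin (2 * (2 * π * x)) * (2 * (2 * π))) : ℝ) + (-sin (2 * π * x) * (2 * π) : ℝ) * Complex.I) x :=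
    (((lin_d2 x).cos.const_mul (-c)).ofReal_comp).add (((lin_d x).cos.ofReal_comp).mul_const _)
  have hs : ((-c * cos (2 * (2 * π * x)) : ℝ) + (cos (2 * π * x) : ℝ) * Complex.I) ∈ Complex.slitPlane := by
    rw [Complex.mem_slitPlane_iff]
    by_cases h : cos (2 * π * x) = 0
    · left
      rw [cos_two_mul, h]; simpa using hc
    · right
      simpa [-Complex.ofReal_cos] using h
  have := Complex.imCLM.hasFDerivAt.comp_hasDerivAt x (hw.clog_real hs)
  refine HasDerivAt.congr_deriv (f := FF c) this ?_
  have hp := (den_pos hc (2 * π * x)).ne'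
  rw [Complex.imCLM_apply, Complex.div_im]
  rw [show Complex.normSq ((-c * cos (2 * (2 * π * x)) : ℝ) + (cos (2 * π * x) : ℝ) * Complex.I) = cos (2 * π * x) ^ 2 + (c * cos (2 * (2 * π * x))) ^ 2 by
    rw [Complex.normSq_add_mul_I]; ring]
  simp only [Complex.add_re, Complex.add_im, Complex.ofReal_re, Complex.ofReal_im, Complex.re_ofReal_mul, Complex.im_ofReal_mul, Complex.I_re, Complex.I_im]
  unfold kk
  rw [← sub_div]
  congr 1
  rw [sin_two_mul, cos_two_mul]
  ring

lemma eight_tc {c : ℝ} (hc : 0 < c) :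
    totalCurv (eight c) = 4 * Complex.arg ((-c : ℝ) + Complex.I) := by
  have hi : ∀ s t, IntervalIntegrable (fun x => |kk c x|) volume s t :=
    fun s t => (kk_cont hc).abs.intervalIntegrable _ _
  have hF : ∀ a b, ∫ x in a..b, kk c x = FF c b - FF c a := fun a b =>
    integral_eq_sub_of_hasDerivAt (fun x _ => FF_d hc x) ((kk_cont hc).intervalIntegrable _ _)
  have hpi := pi_pos
  have i1 : ∫ x in (0:ℝ)..(1/2), |kk c x| = FF c 0 - FF c (1/2) := by
    rw [← neg_sub, ← hF, ← intervalIntegral.integral_neg]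
    apply integral_congr
    intro x hx
    rw [uIcc_of_le (by norm_num)] at hx
    have hs : 0 ≤ sin (2 * π * x) := 
      sin_nonneg_of_nonneg_of_le_pi (by have := hx.1; positivity) (by nlinarith [hx.2])
    apply abs_of_nonpos
    unfold kk
    apply div_nonpos_of_nonpos_of_nonneg
    · rw [mul_neg]; apply neg_nonpos_of_nonneg; positivity
    · positivity
  have i2 : ∫ x in (1/2:ℝ)..1, |kk c x| = FF c 1 - FF c (1/2) := by
    rw [← hF]
    apply integral_congr
    intro x hx
    rw [uIcc_of_le (by norm_num)] at hx
    have hs : 0 ≤ sin (2 * π * x - π) := 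
      sin_nonneg_of_nonneg_of_le_pi (by nlinarith [hx.1]) (by nlinarith [hx.2])
    rw [sin_sub_pi] at hs
    apply abs_of_nonneg
    unfold kk
    rw [show (- (c * sin (2 * π * x) * (1 + 2 * cos (2 * π * x) ^ 2))) = (c * (-sin (2 * π * x)) * (1 + 2 * cos (2 * π * x) ^ 2)) by ring]
    positivity
  have f0 : FF c 0 = Complex.arg ((-c : ℝ) + Complex.I) := by
    simp [FF, Complex.log_im]
  have f1 : FF c 1 = Complex.arg ((-c : ℝ) + Complex.I) := by
    have : cos (2 * (2 * π)) = 1 := by rw [cos_two_mul]; norm_num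
    simp only [FF, Complex.log_im, mul_one, this, cos_two_pi]
    simp
  have f2 : FF c (1/2) = - Complex.arg ((-c : ℝ) + Complex.I) := by
    have e : 2 * π * (1/2) = π := by ring
    rw [FF, Complex.log_im, e, cos_two_pi, cos_pi]
    have : ((-c * 1 : ℝ) : ℂ) + ((-1 : ℝ) : ℂ) * Complex.I = (starRingEnd ℂ) ((-c : ℝ) + Complex.I) := by
      simp
    rw [this, Complex.arg_conj, if_neg]
    intro h
    rw [Complex.arg_eq_pi_iff] at h
    simp at h
  unfold totalCurv
  simp_rw [eight_curv hc]
  rw [← integral_add_adjacent_intervals (hi 0 (1/2)) (hi (1/2) 1), i1, i2, f0, f1, f2]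
  ring

lemma le_of_eight {b : ℝ} (h : ∀ c > 0, b ≤ totalCurv (eight c)) : b ≤ 2 * π := by
  have ht : Filter.Tendsto (fun c : ℝ => 4 * Complex.arg ((-c : ℝ) + Complex.I)) 
      (nhdsWithin 0 (Ioi 0)) (nhds (2 * π)) := by
    have hca : ContinuousAt (fun c : ℝ => 4 * Complex.arg ((-c : ℝ) + Complex.I)) 0 := by
      apply ContinuousAt.mul continuousAt_const
      apply ContinuousAt.comp (g := Complex.arg)
      · apply Complex.continuousAt_arg
        rw [Complex.mem_slitPlane_iff]; right; simp
      · fun_prop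
    have := hca.tendsto
    simp only [neg_zero, Complex.ofReal_zero, zero_add, Complex.arg_I] at this
    rw [show 4 * (π / 2) = 2 * π by ring] at this
    exact this.mono_left nhdsWithin_le_nhds
  refine ge_of_tendsto ht ?_
  filter_upwards [self_mem_nhdsWithin] with c hc
  rw [← eight_tc hc]
  exact h c hc

/-- The infimum of the total curvature over non-embedded closed `C²` immersions equals `2π`,
it coincides with the infimum over all closed `C²` immersions, and the infimum over
non-embedded immersions is not attained: every non-embedded immersion has `K(γ) > 2π`. -/
theorem total_curvature_infimum :
    IsGLB {k : ℝ | ∃ γ : ℝ → R2,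
        IsClosedC2 γ ∧ ImmersedC γ ∧ NonInjectiveC γ ∧ k = totalCurv γ} (2 * π) ∧
    IsGLB {k : ℝ | ∃ γ : ℝ → R2,
        IsClosedC2 γ ∧ ImmersedC γ ∧ k = totalCurv γ} (2 * π) ∧
    (∀ γ : ℝ → R2, IsClosedC2 γ → ImmersedC γ → NonInjectiveC γ → 2 * π < totalCurv γ) := by
  refine ⟨⟨?_, ?_⟩, ⟨?_, ?_⟩, tc_gt⟩
  · rintro k ⟨γ, hc, hi, -, rfl⟩
    exact tc_ge γ hc hi
  · intro b hb
    refine le_of_eight fun c hc => hb ⟨eight c, ?_⟩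
    obtain ⟨h1, h2, h3⟩ := eight_props hc
    exact ⟨h1, h2, h3, rfl⟩
  · rintro k ⟨γ, hc, hi, rfl⟩
    exact tc_ge γ hc hi
  · intro b hb
    refine le_of_eight fun c hc => hb ⟨eight c, ?_⟩
    obtain ⟨h1, h2, -⟩ := eight_props hc
    exact ⟨h1, h2, rfl⟩
end
end

section
/- Let m* ∈ (0,1) be the unique root of m ↦ 2E(m) − K(m) and set c* := 64(4m* − 2)·E(m*)². Every smooth closed constrained elastica γ: S¹ → ℝ² that is not injective satisfies E(γ)·L(γ) ≥ c*. -/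
open Real MeasureTheory Set Function intervalIntegral

noncomputable section

/-- The complete elliptic integral of the first kind `K(m)`. -/
def Kel (m : ℝ) : ℝ := ∫ θ in (0:ℝ)..(π/2), 1 / Real.sqrt (1 - m * Real.sin θ ^ 2)

/-- The complete elliptic integral of the second kind `E(m)`. -/
def Eel (m : ℝ) : ℝ := ∫ θ in (0:ℝ)..(π/2), Real.sqrt (1 - m * Real.sin θ ^ 2)

/-- The incomplete elliptic integral of the first kind `F(x, m)`. -/
def Fel (x m : ℝ) : ℝ := ∫ θ in (0:ℝ)..x, 1 / Real.sqrt (1 - m * Real.sin θ ^ 2)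

/-- The incomplete elliptic integral of the second kind `E(x, m)`. -/
def EelInc (x m : ℝ) : ℝ := ∫ θ in (0:ℝ)..x, Real.sqrt (1 - m * Real.sin θ ^ 2)

/-- The arc-length derivative `∂ₛ f = |γ'|⁻¹ ∂ₓ f` of a scalar function along `γ`. -/
def arcDeriv (γ : ℝ → R2) (f : ℝ → ℝ) (x : ℝ) : ℝ := deriv f x / ‖deriv γ x‖


lemma aux_rotation (u w g Ψ : ℝ → ℝ) (hu : ∀ x, HasDerivAt u (-(g x * w x)) x)
    (hw : ∀ x, HasDerivAt w (g x * u x) x) (hΨ : ∀ x, HasDerivAt Ψ (g x) x)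
    (h1 : ∀ x, u x ^ 2 + w x ^ 2 = 1) :
    ∃ c : ℝ, ∀ x, u x = Real.cos (c + Ψ x) ∧ w x = Real.sin (c + Ψ x) := by
  have hP : ∀ x, HasDerivAt (fun x => u x * Real.cos (Ψ x) + w x * Real.sin (Ψ x)) 0 x := by
    intro x
    have := ((hu x).mul (hΨ x).cos).add ((hw x).mul (hΨ x).sin)
    exact this.congr_deriv (by ring)
  have hQ : ∀ x, HasDerivAt (fun x => w x * Real.cos (Ψ x) - u x * Real.sin (Ψ x)) 0 x := by
    intro x
    have := ((hw x).mul (hΨ x).cos).sub ((hu x).mul (hΨ x).sin)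
    exact this.congr_deriv (by ring)
  have cP := fun x => is_const_of_deriv_eq_zero (fun x => (hP x).differentiableAt)
    (fun x => (hP x).deriv) x 0
  have cQ := fun x => is_const_of_deriv_eq_zero (fun x => (hQ x).differentiableAt)
    (fun x => (hQ x).deriv) x 0
  beta_reduce at cP cQ
  set P := u 0 * Real.cos (Ψ 0) + w 0 * Real.sin (Ψ 0) with hPd
  set Q := w 0 * Real.cos (Ψ 0) - u 0 * Real.sin (Ψ 0) with hQd
  have hPQ : P ^ 2 + Q ^ 2 = 1 := by
    have e1 := Real.sin_sq_add_cos_sq (Ψ 0)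
    have e2 := h1 0
    have : P ^ 2 + Q ^ 2 = (u 0 ^ 2 + w 0 ^ 2) * (Real.sin (Ψ 0) ^ 2 + Real.cos (Ψ 0) ^ 2) := by
      rw [hPd, hQd]; ring
    rw [this, e1, e2]; norm_num
  obtain ⟨c, hc1, hc2⟩ : ∃ c : ℝ, P = Real.cos c ∧ Q = Real.sin c := by
    have hn : ‖(⟨P, Q⟩ : ℂ)‖ = 1 := by
      rw [Complex.norm_def, Complex.normSq_mk, Real.sqrt_eq_one]; linarith
    have h0 : (⟨P, Q⟩ : ℂ) ≠ 0 := by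
      intro h; rw [h] at hn; simp at hn
    refine ⟨Complex.arg ⟨P, Q⟩, ?_, ?_⟩
    · rw [Complex.cos_arg h0, hn]; simp
    · rw [Complex.sin_arg, hn]; simp
  refine ⟨c, fun x => ?_⟩
  have e1 := Real.sin_sq_add_cos_sq (Ψ x)
  rw [Real.cos_add, Real.sin_add, ← hc1, ← hc2, ← cP x, ← cQ x]
  constructor
  · linear_combination (-u x) * e1
  · linear_combination (-w x) * e1

lemma aux_angle {s t : ℝ} (hc : Real.cos s = Real.cos t) (hs : Real.sin s = Real.sin t) :
    ∃ n : ℤ, s - t = n * (2 * π) := by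
  have h : Real.cos (s - t) = 1 := by
    rw [Real.cos_sub, hc, hs]; nlinarith [Real.sin_sq_add_cos_sq t]
  obtain ⟨n, hn⟩ := (Real.cos_eq_one_iff _).1 h
  exact ⟨n, hn.symm⟩

lemma aux_D_pos {m : ℝ} (hm : m ∈ Set.Ioo (0:ℝ) 1) (θ : ℝ) : 0 < 1 - m * Real.sin θ ^ 2 := by
  have := Real.sin_sq_le_one θ
  nlinarith [hm.1, hm.2, sq_nonneg (Real.sin θ)]

lemma aux_cont_E (m : ℝ) : Continuous (fun θ : ℝ => Real.sqrt (1 - m * Real.sin θ ^ 2)) := by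
  fun_prop

lemma aux_cont_K {m : ℝ} (hm : m ∈ Set.Ioo (0:ℝ) 1) :
    Continuous (fun θ : ℝ => 1 / Real.sqrt (1 - m * Real.sin θ ^ 2)) :=
  continuous_const.div (aux_cont_E m) (fun θ => (Real.sqrt_pos.2 (aux_D_pos hm θ)).ne')

lemma aux_period (f : ℝ → ℝ) (hf : Continuous f) (hp : ∀ x, f (π - x) = f x)
    (hp2 : Function.Periodic f π) (t : ℝ) (n : ℤ) :
    ∫ x in t..(t + n * (2 * π)), f x = 4 * n * ∫ x in (0:ℝ)..(π/2), f x := by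
  have h1 : t + n * (2 * π) = t + (2 * n) • π := by
    rw [zsmul_eq_mul]; push_cast; ring
  rw [h1, hp2.intervalIntegral_add_zsmul_eq, hp2.intervalIntegral_add_eq t 0, zsmul_eq_mul]
  have h2 : ∫ x in (0:ℝ)..(0 + π), f x = 2 * ∫ x in (0:ℝ)..(π/2), f x := by
    rw [← intervalIntegral.integral_add_adjacent_intervals (b := π/2)
      (hf.intervalIntegrable _ _) (hf.intervalIntegrable _ _)]
    have : ∫ x in (π/2)..(0+π), f x = ∫ x in (0:ℝ)..(π/2), f x := by
      have h3 := intervalIntegral.integral_comp_sub_left (a := 0) (b := π/2) f π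
      simp only [hp] at h3
      rw [h3]; congr 1 <;> ring
    rw [this]; ring
  · rw [h2]; push_cast; ring
  · exact fun a b => hf.intervalIntegrable a b

lemma aux_root_unique {m m' : ℝ} (hm : m ∈ Set.Ioo (0:ℝ) 1) (hm' : m' ∈ Set.Ioo (0:ℝ) 1)
    (h : 2 * Eel m - Kel m = 0) (h' : 2 * Eel m' - Kel m' = 0) : m' = m := by
  have key : ∀ a b : ℝ, a ∈ Set.Ioo (0:ℝ) 1 → b ∈ Set.Ioo (0:ℝ) 1 → a < b →
      2 * Eel b - Kel b < 2 * Eel a - Kel a := by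
    intro a b ha hb hab
    have e : ∀ a : ℝ, a ∈ Set.Ioo (0:ℝ) 1 → 2 * Eel a - Kel a =
        ∫ θ in (0:ℝ)..(π/2), (2 * Real.sqrt (1 - a * Real.sin θ ^ 2) -
          1 / Real.sqrt (1 - a * Real.sin θ ^ 2)) := by
      intro a ha
      rw [intervalIntegral.integral_sub, intervalIntegral.integral_const_mul]
      · rfl
      · exact ((aux_cont_E a).const_mul 2).intervalIntegrable _ _
      · exact (aux_cont_K ha).intervalIntegrable _ _
    rw [e a ha, e b hb]
    have hpi := Real.pi_pos
    have hle : ∀ θ : ℝ, Real.sqrt (1 - b * Real.sin θ ^ 2) ≤ Real.sqrt (1 - a * Real.sin θ ^ 2) := by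
      intro θ
      apply Real.sqrt_le_sqrt
      nlinarith [sq_nonneg (Real.sin θ)]
    have hpos := fun θ => Real.sqrt_pos.2 (aux_D_pos hb θ)
    apply intervalIntegral.integral_lt_integral_of_continuousOn_of_le_of_exists_lt (by positivity)
    · exact (((aux_cont_E b).const_mul 2).sub (aux_cont_K hb)).continuousOn
    · exact (((aux_cont_E a).const_mul 2).sub (aux_cont_K ha)).continuousOn
    · intro θ _
      have := one_div_le_one_div_of_le (hpos θ) (hle θ)
      linarith [hle θ]
    · refine ⟨π/2, ⟨by positivity, le_rfl⟩, ?_⟩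
      have := one_div_le_one_div_of_le (hpos (π/2)) (hle (π/2))
      have h2 : Real.sqrt (1 - b * Real.sin (π/2) ^ 2) < Real.sqrt (1 - a * Real.sin (π/2) ^ 2) := by
        apply Real.sqrt_lt_sqrt (aux_D_pos hb _).le
        rw [Real.sin_pi_div_two]; linarith
      linarith
  rcases lt_trichotomy m m' with hl | hl | hl
  · have := key _ _ hm hm' hl; linarith
  · exact hl.symm
  · have := key _ _ hm' hm hl; linarith

lemma aux_circle {m : ℝ} (hm : m ∈ Set.Ioo (0:ℝ) 1) :
    64 * (4 * m - 2) * (Eel m) ^ 2 ≤ 16 * π ^ 2 := by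
  obtain ⟨h0, h1⟩ := hm
  have hpi := Real.pi_pos
  set t := Real.sqrt (1 - m / 2) with ht
  have ht2 : t ^ 2 = 1 - m / 2 := Real.sq_sqrt (by linarith)
  have htp : 0 < t := Real.sqrt_pos.2 (by linarith)
  have hE0 : 0 ≤ Eel m :=
    intervalIntegral.integral_nonneg (by positivity) (fun _ _ => Real.sqrt_nonneg _)
  have hE : Eel m ≤ π / 2 * t := by
    have hle : Eel m ≤ ∫ θ in (0:ℝ)..(π/2), ((1 - m * Real.sin θ ^ 2) / t + t) / 2 := by
      apply intervalIntegral.integral_mono_on (by positivity)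
      · exact (aux_cont_E m).intervalIntegrable _ _
      · apply Continuous.intervalIntegrable; fun_prop
      · intro θ _
        have hp := (aux_D_pos ⟨h0, h1⟩ θ).le
        have hs := Real.sq_sqrt hp
        set r := Real.sqrt (1 - m * Real.sin θ ^ 2)
        rw [← hs, div_add' _ _ _ htp.ne', div_div, le_div_iff₀ (by positivity)]
        nlinarith [sq_nonneg (r - t)]
    have hi : ∫ θ in (0:ℝ)..(π/2), ((1 - m * Real.sin θ ^ 2) / t + t) / 2 = π / 2 * t := by
      rw [intervalIntegral.integral_div, intervalIntegral.integral_add,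
        intervalIntegral.integral_div, intervalIntegral.integral_sub,
        intervalIntegral.integral_const_mul, integral_sin_sq]
      · simp
        field_simp
        rw [ht2]; ring
      all_goals apply Continuous.intervalIntegrable; fun_prop
    linarith
  by_cases h2 : 4 * m - 2 ≤ 0
  · have : 64 * (4 * m - 2) * (Eel m) ^ 2 ≤ 0 := by
      apply mul_nonpos_of_nonpos_of_nonneg _ (sq_nonneg _); linarith
    nlinarith [sq_nonneg π]
  · push Not at h2
    have hE2 : Eel m ^ 2 ≤ (π / 2 * t) ^ 2 := pow_le_pow_left₀ hE0 hE 2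
    have h3 : (4 * m - 2) * t ^ 2 ≤ 1 := by rw [ht2]; nlinarith
    calc 64 * (4 * m - 2) * (Eel m) ^ 2 ≤ 64 * (4 * m - 2) * (π / 2 * t) ^ 2 := by gcongr
      _ = 16 * π ^ 2 * ((4 * m - 2) * t ^ 2) := by ring
      _ ≤ 16 * π ^ 2 * 1 := by gcongr
      _ = _ := by ring

/-- Integral of a derivative of a periodic function vanishes. -/
lemma aux_int_zero (f f' : ℝ → ℝ) (hf : ∀ x, HasDerivAt f (f' x) x) (hc : Continuous f')
    (hp : Function.Periodic f 1) : ∫ x in (0:ℝ)..1, f' x = 0 := by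
  rw [intervalIntegral.integral_eq_sub_of_hasDerivAt (fun x _ => hf x)
    (hc.intervalIntegrable _ _)]
  have := hp 0
  rw [zero_add] at this
  rw [this, sub_self]

/-- The wave-like case. -/
lemma aux_wave {m lam A : ℝ} (hm : m ∈ Set.Ioo (0:ℝ) 1) (hroot : 2 * Eel m - Kel m = 0)
    (v κ p : ℝ → ℝ) (hv : Continuous v) (hv0 : ∀ x, 0 < v x)
    (hκ : ∀ x, HasDerivAt κ (v x * p x) x)
    (hp : ∀ x, HasDerivAt p (v x * (lam * κ x - κ x ^ 3 / 2)) x)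
    (pκ : Function.Periodic κ 1) (pp : Function.Periodic p 1)
    (hA : 0 < A) (hl1 : -A < lam) (hl2 : lam < A)
    (hM : ∀ x, p x ^ 2 + (κ x ^ 2 / 2 - lam) ^ 2 = A ^ 2)
    (hclose : ∫ x in (0:ℝ)..1, (κ x ^ 2 / 2 - lam) * v x = 0) :
    ∃ n : ℤ, 1 ≤ n ∧ lam = A * (2 * m - 1) ∧
      Real.sqrt A * (∫ x in (0:ℝ)..1, v x) = 4 * n * Kel m := by
  have cκ : Continuous κ := continuous_iff_continuousAt.2 fun x => (hκ x).continuousAt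
  set k := Real.sqrt (2 * (A + lam)) with hk
  have hk2 : k ^ 2 = 2 * (A + lam) := Real.sq_sqrt (by linarith)
  have hk0 : 0 < k := Real.sqrt_pos.2 (by linarith)
  set R : ℝ → ℝ := fun x => Real.sqrt ((κ x ^ 2 + 2 * (A - lam)) / 4) with hR
  have hRarg : ∀ x, 0 < (κ x ^ 2 + 2 * (A - lam)) / 4 := fun x => by
    have := sq_nonneg (κ x); linarith
  have hR0 : ∀ x, 0 < R x := fun x => Real.sqrt_pos.2 (hRarg x)
  have hR2 : ∀ x, R x ^ 2 = (κ x ^ 2 + 2 * (A - lam)) / 4 := fun x => Real.sq_sqrt (hRarg x).le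
  have cR : Continuous R := by rw [hR]; fun_prop
  have hRd : ∀ x, HasDerivAt R (κ x * (v x * p x) / (4 * R x)) x := by
    intro x
    have h1 : HasDerivAt (fun x => (κ x ^ 2 + 2 * (A - lam)) / 4) (κ x * (v x * p x) / 2) x := by
      have := (((hκ x).pow 2).add_const (2 * (A - lam))).div_const 4
      exact this.congr_deriv (by simp; ring)
    have h2 := h1.sqrt (hRarg x).ne'
    refine h2.congr_deriv ?_
    change _ / (2 * R x) = _
    have := (hR0 x).ne'
    field_simp; ring
  have hp2 : ∀ x, p x ^ 2 = (k ^ 2 - κ x ^ 2) * R x ^ 2 := by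
    intro x; rw [hR2, hk2]; linear_combination hM x
  set u : ℝ → ℝ := fun x => κ x / k with hu
  set w : ℝ → ℝ := fun x => -(p x / (k * R x)) with hw
  have hud : ∀ x, HasDerivAt u (-((v x * R x) * w x)) x := by
    intro x
    have := (hκ x).div_const k
    refine this.congr_deriv ?_
    simp only [hw]
    have := (hR0 x).ne'
    field_simp
  have hwd : ∀ x, HasDerivAt w ((v x * R x) * u x) x := by
    intro x
    have hne := (hR0 x).ne'
    have := ((hp x).div ((hRd x).const_mul k) (mul_ne_zero hk0.ne' hne)).neg
    refine this.congr_deriv ?_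
    have e1 := hp2 x
    have e2 := hR2 x
    have e3 : p x * (k * (κ x * (v x * p x) / (4 * R x))) =
        k * κ x * v x * (k ^ 2 - κ x ^ 2) * R x / 4 := by
      field_simp
      linear_combination (v x) * (κ x) * e1
    rw [e3]
    simp only [hu]
    field_simp
    rw [e2, hk2]
    ring
  have h1 : ∀ x, u x ^ 2 + w x ^ 2 = 1 := by
    intro x
    have hne := (hR0 x).ne'
    have e1 := hp2 x
    simp only [hu, hw]
    field_simp
    rw [e1]; ring
  set Ψ : ℝ → ℝ := fun x => ∫ t in (0:ℝ)..x, v t * R t with hΨ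
  have cvR : Continuous fun t => v t * R t := hv.mul cR
  have hΨd : ∀ x, HasDerivAt Ψ (v x * R x) x := fun x =>
    intervalIntegral.integral_hasDerivAt_right (cvR.intervalIntegrable _ _)
      cvR.aestronglyMeasurable.stronglyMeasurableAtFilter cvR.continuousAt
  obtain ⟨c, hc⟩ := aux_rotation u w _ Ψ hud hwd hΨd h1
  have pu : u 1 = u 0 := by
    have := pκ 0; rw [zero_add] at this; simp only [hu, this]
  have pw : w 1 = w 0 := by
    have h1 := pκ 0; have h2 := pp 0; rw [zero_add] at h1 h2
    simp only [hw, hR, h1, h2]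
  obtain ⟨n, hn⟩ := aux_angle (s := c + Ψ 1) (t := c + Ψ 0)
    (by rw [← (hc 1).1, ← (hc 0).1, pu]) (by rw [← (hc 1).2, ← (hc 0).2, pw])
  have hΨ0 : Ψ 0 = 0 := by simp [hΨ]
  have hΨ1 : 0 < Ψ 1 :=
    intervalIntegral.intervalIntegral_pos_of_pos_on (cvR.intervalIntegrable _ _)
      (fun x _ => mul_pos (hv0 x) (hR0 x)) one_pos
  have hn1 : 1 ≤ n := by
    have h2 : (0:ℝ) < n * (2 * π) := by rw [← hn]; linarith
    have h3 : (0:ℝ) < n := by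
      by_contra h
      push Not at h
      nlinarith [Real.pi_pos]
    have : (0:ℤ) < n := by exact_mod_cast h3
    omega
  set m' := (A + lam) / (2 * A) with hm'd
  have hm' : m' ∈ Set.Ioo (0:ℝ) 1 := by
    constructor
    · apply div_pos <;> linarith
    · rw [hm'd, div_lt_one (by linarith)]; linarith
  have hD : ∀ x, A * (1 - m' * Real.sin (c + Ψ x) ^ 2) = R x ^ 2 := by
    intro x
    rw [← (hc x).2]
    have e : w x ^ 2 = 1 - κ x ^ 2 / k ^ 2 := by
      have := h1 x
      simp only [hu, div_pow] at this
      linarith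
    have e2 := hR2 x
    have hne : A + lam ≠ 0 := by linarith
    rw [e, e2, hk2, hm'd]
    field_simp
    ring
  have hsA : 0 < Real.sqrt A := Real.sqrt_pos.2 hA
  have hsA2 : Real.sqrt A ^ 2 = A := Real.sq_sqrt hA.le
  have hDR : ∀ x, Real.sqrt A * Real.sqrt (1 - m' * Real.sin (c + Ψ x) ^ 2) = R x := by
    intro x
    rw [← Real.sqrt_mul hA.le, hD, Real.sqrt_sq (hR0 x).le]
  have hφd : ∀ x, HasDerivAt (fun x => c + Ψ x) (v x * R x) x := fun x => (hΨd x).const_add c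
  have hend : c + Ψ 1 = c + Ψ 0 + n * (2 * π) := by linarith
  have hsub : ∀ f : ℝ → ℝ, Continuous f →
      ∫ x in (0:ℝ)..1, f (c + Ψ x) * (v x * R x) = ∫ y in (c + Ψ 0)..(c + Ψ 1), f y := by
    intro f hf
    exact intervalIntegral.integral_comp_mul_deriv (fun x _ => hφd x) cvR.continuousOn hf
  have hIK := aux_period _ (aux_cont_K hm') (by intro x; simp only [Real.sin_pi_sub])
    (by intro x; simp only [Real.sin_add_pi, neg_sq]) (c + Ψ 0) n
  have hIE := aux_period _ (aux_cont_E m') (by intro x; simp only [Real.sin_pi_sub])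
    (by intro x; simp only [Real.sin_add_pi, neg_sq]) (c + Ψ 0) n
  rw [← hend, ← hsub _ (aux_cont_K hm')] at hIK
  rw [← hend, ← hsub _ (aux_cont_E m')] at hIE
  change _ = 4 * n * Kel m' at hIK
  change _ = 4 * n * Eel m' at hIE
  have hsq0 : ∀ x, 0 < Real.sqrt (1 - m' * Real.sin (c + Ψ x) ^ 2) := fun x =>
    Real.sqrt_pos.2 (aux_D_pos hm' _)
  have eK : ∀ x, 1 / Real.sqrt (1 - m' * Real.sin (c + Ψ x) ^ 2) * (v x * R x)
      = Real.sqrt A * v x := by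
    intro x
    have := (hsq0 x).ne'
    rw [← hDR x]; field_simp
  have eE : ∀ x, Real.sqrt (1 - m' * Real.sin (c + Ψ x) ^ 2) * (v x * R x)
      = (Real.sqrt A / (2 * A)) * ((κ x ^ 2 / 2 - lam) * v x) + (Real.sqrt A / 2) * v x := by
    intro x
    have h2 := hDR x
    have h3 := hR2 x
    have : Real.sqrt (1 - m' * Real.sin (c + Ψ x) ^ 2) = R x / Real.sqrt A := by
      rw [← h2]; field_simp
    rw [this]
    have h4 : R x / Real.sqrt A * (v x * R x) = R x ^ 2 * v x * Real.sqrt A / Real.sqrt A ^ 2 := by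
      field_simp
    rw [h4, h3, hsA2]
    field_simp
    ring
  simp only [eK] at hIK
  simp only [eE] at hIE
  rw [intervalIntegral.integral_const_mul] at hIK
  rw [intervalIntegral.integral_add
    (Continuous.intervalIntegrable (by fun_prop) _ _)
    (Continuous.intervalIntegrable (by fun_prop) _ _), intervalIntegral.integral_const_mul,
    intervalIntegral.integral_const_mul, hclose] at hIE
  have hnR : (1:ℝ) ≤ n := by exact_mod_cast hn1
  have hroot' : 2 * Eel m' - Kel m' = 0 := by
    have : (4 * (n:ℝ)) * (2 * Eel m' - Kel m') = 0 := by linear_combination hIK - 2 * hIE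
    rcases mul_eq_zero.1 this with h | h
    · linarith
    · exact h
  have hmm := aux_root_unique hm hm' hroot hroot'
  refine ⟨n, hn1, ?_, ?_⟩
  · rw [← hmm, hm'd]; field_simp; ring
  · rw [hIK, hmm]

/-- The circular case. -/
lemma aux_round {k : ℝ} (hk : k ≠ 0) (v a b X Y : ℝ → ℝ) (hv : Continuous v)
    (hv0 : ∀ x, 0 < v x)
    (hX : ∀ x, HasDerivAt X (v x * a x) x) (hY : ∀ x, HasDerivAt Y (v x * b x) x)
    (ha : ∀ x, HasDerivAt a (-(v x * k * b x)) x) (hb : ∀ x, HasDerivAt b (v x * k * a x) x)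
    (hab : ∀ x, a x ^ 2 + b x ^ 2 = 1)
    (pX : Function.Periodic X 1) (pY : Function.Periodic Y 1) (pv : Function.Periodic v 1)
    (x y : ℝ) (hx : 0 ≤ x) (hxy : x < y) (hy : y < 1) (eX : X x = X y) (eY : Y x = Y y) :
    16 * π ^ 2 ≤ k ^ 2 * (∫ x in (0:ℝ)..1, v x) ^ 2 := by
  have cv : Continuous fun t => v t * k := hv.mul continuous_const
  set Ψ : ℝ → ℝ := fun x => ∫ t in (0:ℝ)..x, v t * k with hΨ
  have hΨd : ∀ x, HasDerivAt Ψ (v x * k) x := fun x =>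
    intervalIntegral.integral_hasDerivAt_right (cv.intervalIntegrable _ _)
      cv.aestronglyMeasurable.stronglyMeasurableAtFilter cv.continuousAt
  obtain ⟨c, hc⟩ := aux_rotation a b (fun x => v x * k) Ψ ha hb hΨd hab
  have h1 : ∀ s t, X s - b s / k = X t - b t / k := by
    have h : ∀ x, HasDerivAt (fun x => X x - b x / k) 0 x := fun x =>
      ((hX x).sub ((hb x).div_const k)).congr_deriv (by field_simp; ring)
    exact fun s t => is_const_of_deriv_eq_zero (fun x => (h x).differentiableAt)
      (fun x => (h x).deriv) s t
  have h2 : ∀ s t, Y s + a s / k = Y t + a t / k := by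
    have h : ∀ x, HasDerivAt (fun x => Y x + a x / k) 0 x := fun x =>
      ((hY x).add ((ha x).div_const k)).congr_deriv (by field_simp; ring)
    exact fun s t => is_const_of_deriv_eq_zero (fun x => (h x).differentiableAt)
      (fun x => (h x).deriv) s t
  have key : ∀ s t, s < t → X s = X t → Y s = Y t → 2 * π ≤ |k| * ∫ r in s..t, v r := by
    intro s t hst e1 e2
    have h3 : b s = b t := by
      have := h1 s t
      rw [e1] at this
      field_simp at this
      linarith
    have h4 : a s = a t := by
      have := h2 s t
      rw [e2] at this
      field_simp at this
      linarith
    obtain ⟨n, hn⟩ := aux_angle (s := c + Ψ t) (t := c + Ψ s)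
      (by rw [← (hc s).1, ← (hc t).1, h4]) (by rw [← (hc s).2, ← (hc t).2, h3])
    have h5 : Ψ t - Ψ s = k * ∫ r in s..t, v r := by
      simp only [hΨ]
      rw [intervalIntegral.integral_interval_sub_left (cv.intervalIntegrable _ _)
        (cv.intervalIntegrable _ _), intervalIntegral.integral_mul_const, mul_comm]
    have hpos : 0 < ∫ r in s..t, v r :=
      intervalIntegral.intervalIntegral_pos_of_pos_on (hv.intervalIntegrable _ _)
        (fun x _ => hv0 x) hst
    have h6 : k * ∫ r in s..t, v r = n * (2 * π) := by rw [← h5, ← hn]; ring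
    have h7 : |k| * ∫ r in s..t, v r = |(n:ℝ)| * (2 * π) := by
      rw [← abs_of_pos hpos, ← abs_mul, h6, abs_mul, abs_of_pos Real.two_pi_pos]
    have hn0 : n ≠ 0 := by
      rintro rfl
      have : k * ∫ r in s..t, v r ≠ 0 := mul_ne_zero hk hpos.ne'
      apply this; rw [h6]; simp
    have h8 : (1:ℝ) ≤ |(n:ℝ)| := by exact_mod_cast Int.one_le_abs hn0
    rw [h7]
    nlinarith [Real.pi_pos]
  have k1 := key x y hxy eX eY
  have k2 := key y (x + 1) (by linarith) (by rw [pX, eX]) (by rw [pY, eY])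
  have k3 : (∫ r in x..y, v r) + ∫ r in y..(x+1), v r = ∫ r in x..(x+1), v r :=
    intervalIntegral.integral_add_adjacent_intervals (hv.intervalIntegrable _ _)
      (hv.intervalIntegrable _ _)
  have k4 : ∫ r in x..(x+1), v r = ∫ r in (0:ℝ)..1, v r := by
    have := pv.intervalIntegral_add_eq x 0
    rw [zero_add] at this
    exact this
  rw [k4] at k3
  have k5 : 4 * π ≤ |k| * ∫ r in (0:ℝ)..1, v r := by rw [← k3, mul_add]; linarith
  have k6 := pow_le_pow_left₀ (by positivity) k5 2
  rw [mul_pow, mul_pow, sq_abs] at k6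
  linarith

/-- The statement in terms of scalar functions. -/
lemma aux_core {m lam : ℝ} (hm : m ∈ Set.Ioo (0:ℝ) 1) (hroot : 2 * Eel m - Kel m = 0)
    (v a b X Y κ p : ℝ → ℝ) (hv : Continuous v) (hv0 : ∀ x, 0 < v x)
    (hX : ∀ x, HasDerivAt X (v x * a x) x) (hY : ∀ x, HasDerivAt Y (v x * b x) x)
    (ha : ∀ x, HasDerivAt a (-(v x * κ x * b x)) x)
    (hb : ∀ x, HasDerivAt b (v x * κ x * a x) x)
    (hκ : ∀ x, HasDerivAt κ (v x * p x) x)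
    (hp : ∀ x, HasDerivAt p (v x * (lam * κ x - κ x ^ 3 / 2)) x)
    (hab : ∀ x, a x ^ 2 + b x ^ 2 = 1)
    (pX : Function.Periodic X 1) (pY : Function.Periodic Y 1) (pv : Function.Periodic v 1)
    (pκ : Function.Periodic κ 1) (pp : Function.Periodic p 1)
    (x y : ℝ) (hx : 0 ≤ x) (hxy : x < y) (hy : y < 1) (eX : X x = X y) (eY : Y x = Y y) :
    64 * (4 * m - 2) * (Eel m) ^ 2 ≤
      (∫ x in (0:ℝ)..1, κ x ^ 2 * v x) * (∫ x in (0:ℝ)..1, v x) := by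
  have cκ : Continuous κ := continuous_iff_continuousAt.2 fun x => (hκ x).continuousAt
  have cp : Continuous p := continuous_iff_continuousAt.2 fun x => (hp x).continuousAt
  have ca : Continuous a := continuous_iff_continuousAt.2 fun x => (ha x).continuousAt
  have cb : Continuous b := continuous_iff_continuousAt.2 fun x => (hb x).continuousAt
  set L := ∫ x in (0:ℝ)..1, v x with hL
  have hL0 : 0 < L := intervalIntegral.intervalIntegral_pos_of_pos_on (hv.intervalIntegrable _ _)
    (fun x _ => hv0 x) one_pos
  have hq : ∀ x, HasDerivAt (fun x => κ x ^ 2 / 2 - lam) (κ x * (v x * p x)) x := fun x =>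
    ((((hκ x).pow 2).div_const 2).sub_const lam).congr_deriv (by simp; ring)
  obtain ⟨c1, hc1⟩ : ∃ c1, ∀ x, -(p x * b x) + (κ x ^ 2 / 2 - lam) * a x = c1 := by
    have h : ∀ x, HasDerivAt (fun x => -(p x * b x) + (κ x ^ 2 / 2 - lam) * a x) 0 x := fun x =>
      (((hp x).mul (hb x)).neg.add ((hq x).mul (ha x))).congr_deriv (by ring)
    exact ⟨_, fun x => is_const_of_deriv_eq_zero (fun x => (h x).differentiableAt)
      (fun x => (h x).deriv) x 0⟩
  obtain ⟨c2, hc2⟩ : ∃ c2, ∀ x, p x * a x + (κ x ^ 2 / 2 - lam) * b x = c2 := by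
    have h : ∀ x, HasDerivAt (fun x => p x * a x + (κ x ^ 2 / 2 - lam) * b x) 0 x := fun x =>
      (((hp x).mul (ha x)).add ((hq x).mul (hb x))).congr_deriv (by ring)
    exact ⟨_, fun x => is_const_of_deriv_eq_zero (fun x => (h x).differentiableAt)
      (fun x => (h x).deriv) x 0⟩
  have hM : ∀ x, p x ^ 2 + (κ x ^ 2 / 2 - lam) ^ 2 = c1 ^ 2 + c2 ^ 2 := by
    intro x
    rw [← hc1 x, ← hc2 x]
    linear_combination (-(p x ^ 2 + (κ x ^ 2 / 2 - lam) ^ 2)) * hab x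
  have hclose : ∫ x in (0:ℝ)..1, (κ x ^ 2 / 2 - lam) * v x = 0 := by
    apply aux_int_zero (fun x => c1 * X x + c2 * Y x)
    · intro x
      refine (((hX x).const_mul c1).add ((hY x).const_mul c2)).congr_deriv ?_
      rw [← hc1 x, ← hc2 x]
      linear_combination (v x * (κ x ^ 2 / 2 - lam)) * hab x
    · fun_prop
    · intro x; simp only [pX x, pY x]
  have hEL : ∫ x in (0:ℝ)..1, κ x ^ 2 * v x = 2 * lam * L := by
    have e : ∀ x, κ x ^ 2 * v x = 2 * ((κ x ^ 2 / 2 - lam) * v x) + 2 * lam * v x := by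
      intro x; ring
    simp only [e]
    rw [intervalIntegral.integral_add
      (Continuous.intervalIntegrable (by fun_prop) _ _)
      (Continuous.intervalIntegrable (by fun_prop) _ _), intervalIntegral.integral_const_mul,
      intervalIntegral.integral_const_mul, hclose]
    ring
  by_cases hz : ∀ x, κ x ≠ 0
  · -- no zeros: the curvature is constant
    have h1 : ∫ x in (0:ℝ)..1, (v x * (lam - κ x ^ 2 / 2) - v x * (p x / κ x) ^ 2) = 0 := by
      apply aux_int_zero (fun x => p x / κ x)
      · intro x
        have := hz x
        exact ((hp x).div (hκ x) (hz x)).congr_deriv (by field_simp)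
      · have : Continuous fun x => p x / κ x := cp.div cκ hz
        fun_prop
      · intro x; simp only [pp x, pκ x]
    have cpk : Continuous fun x => p x / κ x := cp.div cκ hz
    have h2 : ∫ x in (0:ℝ)..1, v x * (p x / κ x) ^ 2 = 0 := by
      have e : ∀ x, v x * (p x / κ x) ^ 2 =
        -((κ x ^ 2 / 2 - lam) * v x)
          - (v x * (lam - κ x ^ 2 / 2) - v x * (p x / κ x) ^ 2) := by
        intro x; ring
      rw [intervalIntegral.integral_congr (fun x _ => e x), intervalIntegral.integral_sub
        (Continuous.intervalIntegrable (by fun_prop) _ _)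
        (Continuous.intervalIntegrable (by fun_prop) _ _), intervalIntegral.integral_neg, hclose, h1]
      ring
    have h3 : ∀ x ∈ Set.Icc (0:ℝ) 1, p x = 0 := by
      intro x hx
      by_contra hne
      have hpos : 0 < ∫ x in (0:ℝ)..1, v x * (p x / κ x) ^ 2 := by
        apply intervalIntegral.integral_pos one_pos
          (Continuous.continuousOn (by fun_prop))
        · intro y _
          have := hv0 y
          positivity
        · exact ⟨x, hx, mul_pos (hv0 x) (by have := div_ne_zero hne (hz x); positivity)⟩
      linarith
    have h4 : ∀ x, p x = 0 := by
      intro x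
      obtain ⟨y, hy, hxy⟩ := pp.exists_mem_Ico₀ one_pos x
      rw [hxy]; exact h3 y ⟨hy.1, hy.2.le⟩
    have h5 : ∀ x, κ x = κ 0 := fun x =>
      is_const_of_deriv_eq_zero (fun x => (hκ x).differentiableAt)
        (fun x => by rw [(hκ x).deriv, h4 x, mul_zero]) x 0
    have h6 := aux_round (hz 0) v a b X Y hv hv0 hX hY
      (fun x => by have := ha x; rwa [h5 x] at this)
      (fun x => by have := hb x; rwa [h5 x] at this) hab pX pY pv x y hx hxy hy eX eY
    have h7 : ∫ x in (0:ℝ)..1, κ x ^ 2 * v x = κ 0 ^ 2 * L := by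
      rw [← intervalIntegral.integral_const_mul]
      exact intervalIntegral.integral_congr (fun x _ => by simp only [h5 x])
    rw [h7]
    have := aux_circle hm
    nlinarith
  · push Not at hz
    obtain ⟨x0, hx0⟩ := hz
    have hM0 := hM x0
    rw [hx0] at hM0
    by_cases hp0 : p x0 = 0
    · -- straight line: impossible
      exfalso
      rw [hp0] at hM0
      have hpe : ∀ x, p x ^ 2 = κ x ^ 2 * (lam - κ x ^ 2 / 4) := by
        intro x; have := hM x; rw [← hM0] at this; linear_combination this
      set C := |lam| + 1 with hC
      have hCp : 0 < C := by positivity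
      have hbd : ∀ x, 2 * (κ x * p x) ≤ 2 * C * κ x ^ 2 := by
        intro x
        have h1 : p x ^ 2 ≤ (C * κ x) ^ 2 := by
          rw [hpe]
          have h2 : lam ≤ |lam| := le_abs_self _
          have h3 : lam - κ x ^ 2 / 4 ≤ C ^ 2 := by
            nlinarith [sq_nonneg (κ x), abs_nonneg lam, sq_nonneg (|lam|)]
          nlinarith [sq_nonneg (κ x)]
        have h4 := sq_le_sq.1 h1
        have h5 : κ x * p x ≤ |κ x| * |p x| := by rw [← abs_mul]; exact le_abs_self _
        rw [abs_mul, abs_of_pos hCp] at h4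
        have h6 : |κ x| * |p x| ≤ |κ x| * (C * |κ x|) := by gcongr
        have h7 : |κ x| * (C * |κ x|) = C * κ x ^ 2 := by rw [← sq_abs (κ x)]; ring
        linarith
      set ℓ : ℝ → ℝ := fun x => ∫ t in (0:ℝ)..x, v t with hℓ
      have hℓd : ∀ x, HasDerivAt ℓ (v x) x := fun x =>
        intervalIntegral.integral_hasDerivAt_right (hv.intervalIntegrable _ _)
          hv.aestronglyMeasurable.stronglyMeasurableAtFilter hv.continuousAt
      have hG : ∀ x, HasDerivAt (fun x => κ x ^ 2 * Real.exp (-(2 * C * ℓ x)))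
          (v x * Real.exp (-(2 * C * ℓ x)) * (2 * (κ x * p x) - 2 * C * κ x ^ 2)) x := fun x =>
        (((hκ x).pow 2).mul (((hℓd x).const_mul (2 * C)).neg.exp)).congr_deriv (by simp; ring)
      have hanti : Antitone (fun x => κ x ^ 2 * Real.exp (-(2 * C * ℓ x))) := by
        apply antitone_of_deriv_nonpos (fun x => (hG x).differentiableAt)
        intro x
        rw [(hG x).deriv]
        apply mul_nonpos_of_nonneg_of_nonpos
        · have := hv0 x; positivity
        · linarith [hbd x]
      have hz1 : ∀ x, x0 ≤ x → κ x = 0 := by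
        intro x hx
        have := hanti hx
        simp only [hx0] at this
        have he := Real.exp_pos (-(2 * C * ℓ x))
        have h8 : κ x ^ 2 ≤ 0 := by
          by_contra h
          push Not at h
          have := mul_pos h he
          linarith
        exact pow_eq_zero_iff (two_ne_zero) |>.1 (le_antisymm h8 (sq_nonneg _))
      have hz2 : ∀ x, κ x = 0 := by
        intro x
        obtain ⟨y, hy, hxy⟩ := pκ.exists_mem_Ico one_pos x x0
        rw [hxy]; exact hz1 y hy.1
      have ha' : ∀ x, a x = a 0 := fun x =>
        is_const_of_deriv_eq_zero (fun x => (ha x).differentiableAt)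
          (fun x => by rw [(ha x).deriv, hz2 x]; ring) x 0
      have hb' : ∀ x, b x = b 0 := fun x =>
        is_const_of_deriv_eq_zero (fun x => (hb x).differentiableAt)
          (fun x => by rw [(hb x).deriv, hz2 x]; ring) x 0
      have iX := aux_int_zero X _ hX (hv.mul ca) pX
      have iY := aux_int_zero Y _ hY (hv.mul cb) pY
      simp only [ha', hb', intervalIntegral.integral_mul_const] at iX iY
      have a0 : a 0 = 0 := by
        rcases mul_eq_zero.1 iX with h | h
        · exact absurd h hL0.ne'
        · exact h
      have b0 : b 0 = 0 := by
        rcases mul_eq_zero.1 iY with h | h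
        · exact absurd h hL0.ne'
        · exact h
      have := hab 0
      rw [a0, b0] at this
      norm_num at this
    · set A := Real.sqrt (c1 ^ 2 + c2 ^ 2) with hA
      have hA2 : A ^ 2 = c1 ^ 2 + c2 ^ 2 := Real.sq_sqrt (by positivity)
      have hAn : 0 ≤ A := Real.sqrt_nonneg _
      have hpp : 0 < p x0 ^ 2 := by positivity
      have hlA : lam ^ 2 < A ^ 2 := by rw [hA2, ← hM0]; linarith
      have habs := abs_lt_of_sq_lt_sq' hlA hAn
      have hA0 : 0 < A := by linarith [habs.1, habs.2]
      obtain ⟨n, hn, hlam, hLK⟩ := aux_wave hm hroot v κ p hv hv0 hκ hp pκ pp hA0 habs.1 habs.2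
        (fun x => by rw [hM x, hA2]) hclose
      have hE0 : 0 ≤ ∫ x in (0:ℝ)..1, κ x ^ 2 * v x :=
        intervalIntegral.integral_nonneg zero_le_one
          (fun x _ => mul_nonneg (sq_nonneg _) (hv0 x).le)
      rw [hEL] at hE0 ⊢
      have hlam0 : 0 ≤ lam := by
        by_contra h
        push Not at h
        nlinarith
      have hm2 : 0 ≤ 2 * m - 1 := by
        by_contra h
        push Not at h
        nlinarith
      have hnR : (1:ℝ) ≤ n := by exact_mod_cast hn
      have hK : Kel m = 2 * Eel m := by linarith
      have hAL : A * L ^ 2 = 64 * n ^ 2 * Eel m ^ 2 := by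
        have : (Real.sqrt A * L) ^ 2 = (4 * n * Kel m) ^ 2 := by rw [hLK]
        rw [mul_pow, Real.sq_sqrt hAn, hK] at this
        rw [this]; ring
      have e : 2 * lam * L * L = 2 * (2 * m - 1) * (A * L ^ 2) := by rw [hlam]; ring
      rw [e, hAL]
      have hn2 : (1:ℝ) ≤ (n:ℝ) ^ 2 := one_le_pow₀ hnR
      have h9 : 0 ≤ (2 * m - 1) * Eel m ^ 2 := by positivity
      nlinarith

/-- Every smooth closed constrained elastica (`∂ₛ²κ + κ³/2 - λκ = 0` for some `λ ∈ ℝ`)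
that is not injective satisfies `E(γ)·L(γ) ≥ c* = 64(4m* - 2)E(m*)²`, where `m*` is the
root of `m ↦ 2E(m) - K(m)` in `(0,1)`. -/
theorem nonembedded_elastica_energy_bound (m : ℝ) (hm : m ∈ Set.Ioo (0:ℝ) 1)
    (hroot : 2 * Eel m - Kel m = 0)
    (γ : ℝ → R2) (hper : Function.Periodic γ 1) (hsm : ContDiff ℝ (⊤ : ℕ∞) γ)
    (himm : ∀ x, deriv γ x ≠ 0)
    (helast : ∃ lam : ℝ, ∀ x, arcDeriv γ (arcDeriv γ (curvC γ)) x
        + (curvC γ x) ^ 3 / 2 - lam * curvC γ x = 0)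
    (hnoninj : ¬ Set.InjOn γ (Set.Ico (0:ℝ) 1)) :
    64 * (4 * m - 2) * (Eel m) ^ 2 ≤
      (∫ x in (0:ℝ)..1, (curvC γ x) ^ 2 * ‖deriv γ x‖) *
        (∫ x in (0:ℝ)..1, ‖deriv γ x‖) := by
  obtain ⟨lam, hlam⟩ := helast
  obtain ⟨x, y, hx, hy, hxy, heq⟩ : ∃ x y : ℝ, 0 ≤ x ∧ y < 1 ∧ x < y ∧ γ x = γ y := by
    simp only [Set.InjOn, not_forall] at hnoninj
    obtain ⟨x, hx, y, hy, he, hne⟩ := hnoninj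
    rcases lt_or_gt_of_ne hne with h | h
    · exact ⟨x, y, hx.1, hy.2, h, he⟩
    · exact ⟨y, x, hy.1, hx.2, h, he.symm⟩
  have hs1 : ContDiff ℝ (⊤ : ℕ∞) (deriv γ) := ((contDiff_infty_iff_deriv).1 hsm).2
  have hs2 : ContDiff ℝ (⊤ : ℕ∞) (deriv (deriv γ)) := ((contDiff_infty_iff_deriv).1 hs1).2
  have pγ1 : Function.Periodic (deriv γ) 1 := by
    intro x
    rw [← deriv_comp_add_const]
    congr 1
    exact funext hper
  have pγ2 : Function.Periodic (deriv (deriv γ)) 1 := by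
    intro x
    rw [← deriv_comp_add_const]
    congr 1
    exact funext pγ1
  have hcoord : ∀ (f : ℝ → R2) (f' : R2) (x : ℝ) (i : Fin 2), HasDerivAt f f' x →
      HasDerivAt (fun x => f x i) (f' i) x := by
    intro f f' x i h
    exact ((EuclideanSpace.proj i : R2 →L[ℝ] ℝ).hasFDerivAt.comp_hasDerivAt x h)
  have hd1 : ∀ x, HasDerivAt γ (deriv γ x) x := fun x =>
    (hsm.differentiable (by simp) x).hasDerivAt
  have hd2 : ∀ x, HasDerivAt (deriv γ) (deriv (deriv γ) x) x := fun x =>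
    (hs1.differentiable (by simp) x).hasDerivAt
  set v : ℝ → ℝ := fun x => ‖deriv γ x‖ with hv
  have hv0 : ∀ x, 0 < v x := fun x => norm_pos_iff.2 (himm x)
  have hv2 : ∀ x, v x ^ 2 = deriv γ x 0 ^ 2 + deriv γ x 1 ^ 2 := by
    intro x
    simp only [hv]
    rw [EuclideanSpace.norm_sq_eq]
    simp [Fin.sum_univ_two]
  have sv : ContDiff ℝ (⊤ : ℕ∞) v := hs1.norm ℝ himm
  have hvd : ∀ x, HasDerivAt v ((deriv γ x 0 * deriv (deriv γ) x 0
      + deriv γ x 1 * deriv (deriv γ) x 1) / v x) x := by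
    intro x
    have h1 := (sv.differentiable (by simp) x).hasDerivAt
    have h2 := h1.pow 2
    have h3 := ((hcoord _ _ x 0 (hd2 x)).pow 2).add ((hcoord _ _ x 1 (hd2 x)).pow 2)
    have h4 : (v ^ 2 : ℝ → ℝ) = (fun x => deriv γ x 0) ^ 2 + (fun x => deriv γ x 1) ^ 2 := by
      funext x; simpa using hv2 x
    rw [h4] at h2
    have h5 := h2.unique h3
    refine h1.congr_deriv ?_
    rw [eq_div_iff (hv0 x).ne']
    simp at h5
    linarith
  have cc : ∀ (f : ℝ → R2) (i : Fin 2), ContDiff ℝ (⊤ : ℕ∞) f →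
      ContDiff ℝ (⊤ : ℕ∞) (fun x => f x i) := by
    intro f i h
    exact (contDiff_euclidean.1 h) i
  have sκ : ContDiff ℝ (⊤ : ℕ∞) (curvC γ) := by
    unfold curvC det2
    refine ContDiff.div ?_ (sv.pow 3) (fun x => (pow_pos (hv0 x) 3).ne')
    exact ((cc _ 0 hs1).mul (cc _ 1 hs2)).sub ((cc _ 1 hs1).mul (cc _ 0 hs2))
  have sp : ContDiff ℝ (⊤ : ℕ∞) (arcDeriv γ (curvC γ)) := by
    unfold arcDeriv
    exact ContDiff.div ((contDiff_infty_iff_deriv).1 sκ).2 sv (fun x => (hv0 x).ne')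
  have pv : Function.Periodic v 1 := by intro x; simp only [hv, pγ1 x]
  have pκ : Function.Periodic (curvC γ) 1 := by
    intro x; simp only [curvC, pγ1 x, pγ2 x]
  have pdκ : Function.Periodic (deriv (curvC γ)) 1 := by
    intro x
    rw [← deriv_comp_add_const]
    congr 1
    exact funext pκ
  have pp : Function.Periodic (arcDeriv γ (curvC γ)) 1 := by
    intro x; simp only [arcDeriv, pγ1 x, pdκ x]
  refine aux_core (lam := lam) hm hroot v (fun x => deriv γ x 0 / v x) (fun x => deriv γ x 1 / v x)
    (fun x => γ x 0) (fun x => γ x 1) (curvC γ) (arcDeriv γ (curvC γ)) sv.continuous hv0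
    ?_ ?_ ?_ ?_ ?_ ?_ ?_ ?_ ?_ pv pκ pp x y hx hxy hy (by simp only [heq]) (by simp only [heq])
  · intro x
    refine (hcoord _ _ x 0 (hd1 x)).congr_deriv ?_
    have := (hv0 x).ne'
    field_simp
  · intro x
    refine (hcoord _ _ x 1 (hd1 x)).congr_deriv ?_
    have := (hv0 x).ne'
    field_simp
  · intro x
    have hne := (hv0 x).ne'
    refine ((hcoord _ _ x 0 (hd2 x)).div (hvd x) hne).congr_deriv ?_
    change _ = -(v x * (det2 (deriv γ x) (deriv (deriv γ) x) / v x ^ 3) * _)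
    unfold det2
    field_simp
    rw [hv2 x]; ring
  · intro x
    have hne := (hv0 x).ne'
    refine ((hcoord _ _ x 1 (hd2 x)).div (hvd x) hne).congr_deriv ?_
    change _ = v x * (det2 (deriv γ x) (deriv (deriv γ) x) / v x ^ 3) * _
    unfold det2
    field_simp
    rw [hv2 x]; ring
  · intro x
    refine (sκ.differentiable (by simp) x).hasDerivAt.congr_deriv ?_
    change _ = v x * (_ / v x)
    rw [mul_div_cancel₀ _ (hv0 x).ne']
  · intro x
    refine (sp.differentiable (by simp) x).hasDerivAt.congr_deriv ?_
    have h1 := hlam x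
    have h2 : arcDeriv γ (arcDeriv γ (curvC γ)) x = deriv (arcDeriv γ (curvC γ)) x / v x := rfl
    rw [h2] at h1
    have h3 : deriv (arcDeriv γ (curvC γ)) x / v x = lam * curvC γ x - curvC γ x ^ 3 / 2 := by
      linarith
    rw [← h3, mul_div_cancel₀ _ (hv0 x).ne']
  · intro x
    have hne := (hv0 x).ne'
    simp only [div_pow]
    rw [← add_div, ← hv2 x, div_self (pow_ne_zero 2 hne)]
  · intro x; simp only [hper x]
  · intro x; simp only [hper x]
end
end
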